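/- arXiv:2409.09062 — 4 statements merged into one kernel-verified Lean document; each statement's English description precedes it below -/
import Mathlib

section
/- Existence of the regenerated analysis (one-pass regeneration from an ARTwork): for every assignment g : V → L of values to the key nodes, there exists X : V → L such that X k = g k for every k ∈ K and X satisfies the non-key equations. (Such an X is obtained by strong recursion on the rank r, processing program points in topological order without any fixed-point computation.) -/
/-- Existence of the regenerated analysis: for every assignment
`g : V → L` of values to the key nodes there exists `X : V → L` agreeing with
`g` on `K` and satisfying the non-key equations. -/
theorem regeneration_exists
    {L : Type*} [CompleteLattice L] {V : Type*} [Fintype V]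
    (pred : V → Finset V) (f : V → (L →o L))
    (K : Set V) (r : V → ℕ)
    (htopo : ∀ v ∉ K, ∀ p ∈ pred v, r p < r v)
    (g : V → L) :
    ∃ X : V → L, (∀ k ∈ K, X k = g k) ∧
      (∀ v ∉ K, X v = f v ((pred v).inf X)) := by
  classical
  have hwf : WellFounded (fun p v => r p < r v) := (measure r).wf
  let step (v : V) (X : ∀ p, r p < r v → L) : L :=
    if hv : v ∈ K then g v
    else f v ((pred v).attach.inf fun p => X p (htopo v hv p p.2))
  refine ⟨hwf.fix step, fun k hk => ?_, fun v hv => ?_⟩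
  · rw [hwf.fix_eq]
    exact dif_pos hk
  · rw [hwf.fix_eq]
    refine (dif_neg hv).trans ?_
    rw [← Finset.inf_attach (pred v)]
end

section
/- Uniqueness of the regenerated analysis: if X, Y : V → L both satisfy the non-key equations and X k = Y k for every k ∈ K, then X = Y. (Hence the values at the key nodes — the loop-invariants stored in an ARTwork — determine the data-flow values at all program points.) -/
/-- Uniqueness of the regenerated analysis: if `X` and `Y` both
satisfy the non-key equations and agree on the key nodes, then `X = Y`. -/
theorem regeneration_unique
    {L : Type*} [CompleteLattice L] {V : Type*} [Fintype V]
    (pred : V → Finset V) (f : V → (L →o L))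
    (K : Set V) (r : V → ℕ)
    (htopo : ∀ v ∉ K, ∀ p ∈ pred v, r p < r v)
    (X Y : V → L)
    (hX : ∀ v ∉ K, X v = f v ((pred v).inf X))
    (hY : ∀ v ∉ K, Y v = f v ((pred v).inf Y))
    (hK : ∀ k ∈ K, X k = Y k) :
    X = Y := by
  suffices h : ∀ n v, r v = n → X v = Y v from funext fun v => h (r v) v rfl
  intro n
  induction n using Nat.strong_induction_on with
  | _ n ih =>
    rintro v rfl
    by_cases hv : v ∈ K
    · exact hK v hv
    · rw [hX v hv, hY v hv, Finset.inf_congr rfl fun p hp => ih (r p) (htopo v hv p hp) p rfl]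
end

section
/- Lemma 1 (faithful regeneration of an untampered ARTwork): let R : V → L be a solution of the data-flow system, i.e., F R = R. If X : V → L satisfies the non-key equations and X k = R k for every k ∈ K (the ARTwork encodes the key-node values of R), then X = R; in particular X passes the key checks, so the consumer reports no safety violation and the regenerated results match the producer's results exactly. -/
/-- Lemma 1, faithful regeneration of an untampered ARTwork:
if `R` is a solution of the data-flow system, `X` satisfies the non-key
equations and agrees with `R` on the key nodes, then `X = R`; in particular
`X` passes the key checks. -/
theorem faithful_regeneration
    {L : Type*} [CompleteLattice L] {V : Type*} [Fintype V]
    (pred : V → Finset V) (f : V → (L →o L))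
    (K : Set V) (r : V → ℕ)
    (htopo : ∀ v ∉ K, ∀ p ∈ pred v, r p < r v)
    (R : V → L) (hR : ∀ v, f v ((pred v).inf R) = R v)
    (X : V → L)
    (hX : ∀ v ∉ K, X v = f v ((pred v).inf X))
    (hK : ∀ k ∈ K, X k = R k) :
    X = R ∧ ∀ k ∈ K, X k = f k ((pred k).inf X) := by
  have h : ∀ v, X v = R v := by
    intro v
    induction v using (measure r).wf.induction with
    | _ v ih =>
      by_cases hv : v ∈ K
      · exact hK v hv
      · rw [hX v hv, ← hR v, Finset.inf_congr rfl fun p hp => ih p (htopo v hv p hp)]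
  obtain rfl : X = R := funext h
  exact ⟨rfl, fun k _ => (hR k).symm⟩
end

section
/- Monotonicity of regeneration (conservative tampering yields an over-approximation): if X, Y : V → L both satisfy the non-key equations and X k ≤ Y k for every k ∈ K, then X v ≤ Y v for every v : V. In particular, if R is a solution of the data-flow system and Y is regenerated from key-node values g with R k ≤ g k for all k ∈ K (a conservatively tampered ARTwork), then R v ≤ Y v at every program point, so the regenerated result is a sound over-approximation of the non-tampered result. -/
/-- monotonicity of regeneration: if `X` and `Y` both satisfy
the non-key equations and `X k ≤ Y k` for every key node `k`, then
`X v ≤ Y v` at every program point. -/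
theorem regeneration_monotone
    {L : Type*} [CompleteLattice L] {V : Type*} [Fintype V]
    (pred : V → Finset V) (f : V → (L →o L))
    (K : Set V) (r : V → ℕ)
    (htopo : ∀ v ∉ K, ∀ p ∈ pred v, r p < r v)
    (X Y : V → L)
    (hX : ∀ v ∉ K, X v = f v ((pred v).inf X))
    (hY : ∀ v ∉ K, Y v = f v ((pred v).inf Y))
    (hK : ∀ k ∈ K, X k ≤ Y k) :
    ∀ v, X v ≤ Y v := by
  intro v
  induction h : r v using Nat.strong_induction_on generalizing v with
  | _ n ih =>
    by_cases hv : v ∈ K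
    · exact hK v hv
    · rw [hX v hv, hY v hv]
      exact (f v).monotone <| Finset.inf_mono_fun fun p hp =>
        ih (r p) (h ▸ htopo v hv p hp) p rfl
end
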